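/- For a convex m-thick lattice polygon B, area(B) + (1/2) ∑_{u} def_u(B)² ≥ (3/8) m², where the sum is over primitive directions u ∈ ℤ² and def_u(B) = max(m - ω_u(B), 0) is the defect of B in direction u (only finitely many terms are nonzero). -/

import Mathlib

open Finset Set

/-- Embedding of lattice points into the real plane. -/
def toR (p : ℤ × ℤ) : ℝ × ℝ := ((p.1 : ℝ), (p.2 : ℝ))

/-- Integer pairing `u ⋅ p`. -/
def zdot (u p : ℤ × ℤ) : ℤ := u.1 * p.1 + u.2 * p.2

/-- The lattice points of the convex hull of `B` (the `ℤ`-convex hull). -/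
def latticeHull (B : Finset (ℤ × ℤ)) : Set (ℤ × ℤ) :=
  {p | toR p ∈ convexHull ℝ (toR '' (B : Set (ℤ × ℤ)))}

/-- The lattice width of `B` in the direction `u`. -/
def widthZ (u : ℤ × ℤ) (B : Finset (ℤ × ℤ)) (h : B.Nonempty) : ℤ :=
  B.sup' h (zdot u) - B.inf' h (zdot u)

/-- Lattice points of the face of the hull of `B` where `u ⋅ p` is maximal
(the side of the polygon perpendicular to `u` on the `max` side). -/
def maxFace (u : ℤ × ℤ) (B : Finset (ℤ × ℤ)) (h : B.Nonempty) : Set (ℤ × ℤ) :=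
  {p ∈ latticeHull B | zdot u p = B.sup' h (zdot u)}

/-- Lattice points of the face of the hull of `B` where `u ⋅ p` is minimal. -/
def minFace (u : ℤ × ℤ) (B : Finset (ℤ × ℤ)) (h : B.Nonempty) : Set (ℤ × ℤ) :=
  {p ∈ latticeHull B | zdot u p = B.inf' h (zdot u)}

/-- A finite set `B ⊆ ℤ²` is `m`-thick: it is empty, or its hull is a segment of
integer length at least `m` (i.e. containing at least `m + 1` lattice points), or its hull
is two-dimensional and for every direction `u` in which the lattice width of the
`ℤ`-convex hull is `m - a` with `a > 0`, the hull has two sides perpendicular to `u`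
each of integer length at least `a` (i.e. containing at least `a + 1` lattice points). -/
def MThick (m : ℕ) (B : Finset (ℤ × ℤ)) : Prop :=
  B = ∅ ∨
  (∃ h : B.Nonempty, Collinear ℝ (toR '' (B : Set (ℤ × ℤ))) ∧
    (m : ℤ) + 1 ≤ ((latticeHull B).ncard : ℤ)) ∨
  (∃ h : B.Nonempty, ¬ Collinear ℝ (toR '' (B : Set (ℤ × ℤ))) ∧
    ∀ u : ℤ × ℤ, u ≠ 0 → ∀ a : ℤ, 0 < a → widthZ u B h = (m : ℤ) - a →
      a + 1 ≤ ((maxFace u B h).ncard : ℤ) ∧ a + 1 ≤ ((minFace u B h).ncard : ℤ))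

open MeasureTheory in
/-- The Euclidean area of the convex hull of the lattice points `B`. -/
noncomputable def areaOf (B : Finset (ℤ × ℤ)) : ℝ :=
  (MeasureTheory.volume (convexHull ℝ (toR '' (B : Set (ℤ × ℤ))))).toReal

/-- `u` is a primitive direction: its coordinates are coprime, and we pick one
representative of each pair `{u, -u}`. -/
def IsPrimDir (u : ℤ × ℤ) : Prop :=
  IsCoprime u.1 u.2 ∧ (0 < u.2 ∨ (u.2 = 0 ∧ 0 < u.1))

/-- The defect of `B` in the direction `u`: `max (m - ω_u(B)) 0`. -/
def defect (m : ℕ) (u : ℤ × ℤ) (B : Finset (ℤ × ℤ)) (h : B.Nonempty) : ℤ :=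
  max ((m : ℤ) - widthZ u B h) 0



lemma leg_bound (α β i j : ℝ) (hi : 0 ≤ i) (h : β ≤ α) :
    α * (β - (i + j)) ≤ α * β - α * j - β * i := by
  have := mul_nonneg hi (sub_nonneg.2 h); linarith

lemma comb (U V s1 s2 k2 k4 G2 G4 : ℝ) (hU : 0 ≤ U) (hUV : U ≤ V) (hk : k2 + k4 ≤ 1)
    (f2 : U * (s1 - k2) ≤ G2) (f4 : V * (s2 - k4) ≤ G4) (_g2 : 0 ≤ G2) (g4 : 0 ≤ G4) :
    U * (s1 + s2 - 1) ≤ G2 + G4 := by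
  have h1 : U * (s2 - k4) ≤ G4 := by
    rcases le_total k4 s2 with h | h
    · have := mul_nonneg (sub_nonneg.2 hUV) (sub_nonneg.2 h); linarith
    · have := mul_nonneg hU (sub_nonneg.2 h); linarith
  have := mul_nonneg hU (sub_nonneg.2 hk)
  linarith

lemma core_alg (α β γ δ i2 j2 i4 j4 : ℝ) (hα : 0 ≤ α) (hα1 : α ≤ 1) (hβ : 0 ≤ β) (hβ1 : β ≤ 1)
    (hγ : 0 ≤ γ) (hγ1 : γ ≤ 1) (hδ : 0 ≤ δ) (hδ1 : δ ≤ 1)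
    (hi2 : 0 ≤ i2) (hj2 : 0 ≤ j2) (hi4 : 0 ≤ i4) (hj4 : 0 ≤ j4)
    (hk : i2 + j2 + i4 + j4 ≤ 1)
    (g2 : 0 ≤ α * β - α * j2 - β * i2) (g4 : 0 ≤ γ * δ - δ * j4 - γ * i4)
    (hs : 1 ≤ β + γ ∨ 1 ≤ α + δ) :
    (β + γ - 1) * (α + δ - 1) ≤ 1/4 + (α * β - α * j2 - β * i2) + (γ * δ - δ * j4 - γ * i4) := by
  by_cases h1 : β + γ ≤ 1
  · by_cases h2 : 1 ≤ α + δ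
    · nlinarith [mul_nonneg (sub_nonneg.2 h1) (sub_nonneg.2 h2)]
    · have : β + γ = 1 := by
        rcases hs with h | h
        · linarith
        · exact absurd h h2
      rw [this]; linarith
  by_cases h2 : α + δ ≤ 1
  · nlinarith [mul_nonneg (sub_nonneg.2 (not_le.1 h1).le) (sub_nonneg.2 h2)]
  push Not at h1 h2
  have e1 : 0 ≤ β + γ - 1 := by linarith
  have e2 : 0 ≤ α + δ - 1 := by linarith
  -- helper for the two parallel cases
  have key : ∀ A b D G : ℝ, 0 ≤ b → b ≤ A → A ≤ 1 → G ≤ 1 → D ≤ 1 → 0 ≤ D → 0 ≤ A + D - 1 →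
      0 ≤ b + G - 1 → 
      (b + G - 1) * (A + D - 1) ≤ 1/4 + A * (b + D - 1) ∨ (b + G - 1) * (A + D - 1) ≤ 1/4 := by
    intro A b D G hb hbA hA hG hD hD0 h3 h4
    have u1 : (b + G - 1) * (A + D - 1) ≤ b * (A + D - 1) :=
      mul_le_mul_of_nonneg_right (by linarith) h3
    by_cases h : b + D ≤ 1
    · right
      have : b * (A + D - 1) ≤ b * D := mul_le_mul_of_nonneg_left (by linarith) hb
      nlinarith [sq_nonneg (b - D)]
    · left
      push Not at h
      have : (1 - D) * (A - b) ≤ b * (A - b) :=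
        mul_le_mul_of_nonneg_right (by linarith) (by linarith)
      nlinarith [sq_nonneg (A - 2 * b)]
  rcases le_total β α with hab | hab <;> rcases le_total δ γ with hcd | hcd
  · -- big legs α, γ
    have f2 := leg_bound α β i2 j2 hi2 hab
    have f4 : γ * (δ - (i4 + j4)) ≤ γ * δ - δ * j4 - γ * i4 := by
      have := mul_nonneg hj4 (sub_nonneg.2 hcd); linarith
    rcases le_total α γ with hac | hac
    · have := comb α γ β δ (i2 + j2) (i4 + j4) _ _ hα hac (by linarith) f2 f4 g2 g4
      rcases key α β δ γ hβ hab hα1 hγ1 hδ1 hδ e2 e1 with h | h <;> linarith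
    · have := comb γ α δ β (i4 + j4) (i2 + j2) _ _ hγ hac (by linarith) f4 f2 g4 g2
      rcases key γ δ β α hδ hcd hγ1 hα1 hβ1 hβ (by linarith) (by linarith) with h | h <;> linarith
  · -- α, δ
    have f2 := leg_bound α β i2 j2 hi2 hab
    have f4 : δ * (γ - (i4 + j4)) ≤ γ * δ - δ * j4 - γ * i4 := by
      have := mul_nonneg hi4 (sub_nonneg.2 hcd); linarith
    rcases le_total α δ with hac | hac
    · have := comb α δ β γ (i2 + j2) (i4 + j4) _ _ hα hac (by linarith) f2 f4 g2 g4
      have : (β + γ - 1) * (α + δ - 1) ≤ (β + γ - 1) * α := mul_le_mul_of_nonneg_left (by linarith) e1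
      linarith
    · have := comb δ α γ β (i4 + j4) (i2 + j2) _ _ hδ hac (by linarith) f4 f2 g4 g2
      have : (β + γ - 1) * (α + δ - 1) ≤ (β + γ - 1) * δ := mul_le_mul_of_nonneg_left (by linarith) e1
      linarith
  · -- β, γ
    have f2 : β * (α - (i2 + j2)) ≤ α * β - α * j2 - β * i2 := by
      have := mul_nonneg hj2 (sub_nonneg.2 hab); linarith
    have f4 : γ * (δ - (i4 + j4)) ≤ γ * δ - δ * j4 - γ * i4 := by
      have := mul_nonneg hj4 (sub_nonneg.2 hcd); linarith
    rcases le_total β γ with hac | hac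
    · have := comb β γ α δ (i2 + j2) (i4 + j4) _ _ hβ hac (by linarith) f2 f4 g2 g4
      have : (β + γ - 1) * (α + δ - 1) ≤ β * (α + δ - 1) := mul_le_mul_of_nonneg_right (by linarith) e2
      linarith
    · have := comb γ β δ α (i4 + j4) (i2 + j2) _ _ hγ hac (by linarith) f4 f2 g4 g2
      have : (β + γ - 1) * (α + δ - 1) ≤ γ * (α + δ - 1) := mul_le_mul_of_nonneg_right (by linarith) e2
      linarith
  · -- β, δ
    have f2 : β * (α - (i2 + j2)) ≤ α * β - α * j2 - β * i2 := by
      have := mul_nonneg hj2 (sub_nonneg.2 hab); linarith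
    have f4 : δ * (γ - (i4 + j4)) ≤ γ * δ - δ * j4 - γ * i4 := by
      have := mul_nonneg hi4 (sub_nonneg.2 hcd); linarith
    rcases le_total β δ with hac | hac
    · have := comb β δ α γ (i2 + j2) (i4 + j4) _ _ hβ hac (by linarith) f2 f4 g2 g4
      rcases key β α γ δ hα hab hβ1 hδ1 hγ1 hγ e1 e2 with h | h <;> linarith
    · have := comb δ β γ α (i4 + j4) (i2 + j2) _ _ hδ hac (by linarith) f4 f2 g4 g2
      rcases key δ γ α β hγ hcd hδ1 hβ1 hα1 hα (by linarith) (by linarith) with h | h <;> linarith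

/-- Scaled version. -/
lemma core_scaled (P Q α β γ δ i2 j2 i4 j4 : ℝ) (hP : 0 ≤ P) (hPQ : P ≤ Q)
    (hα1 : α ≤ P) (hβ1 : β ≤ Q) (hγ1 : γ ≤ Q) (hδ1 : δ ≤ P)
    (hi2 : 0 ≤ i2) (hj2 : 0 ≤ j2) (hi4 : 0 ≤ i4) (hj4 : 0 ≤ j4)
    (hk : i2 + j2 + i4 + j4 ≤ P)
    (h2α : i2 + j2 ≤ α) (h2β : i2 + j2 ≤ β) (h4γ : i4 + j4 ≤ γ) (h4δ : i4 + j4 ≤ δ)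
    (hs : Q ≤ β + γ ∨ P ≤ α + δ) :
    (β + γ - Q) * (α + δ - P) ≤ P * Q / 4 + (α * β - α * j2 - β * i2)
      + (γ * δ - δ * j4 - γ * i4) := by
  have g2 : 0 ≤ α * β - α * j2 - β * i2 := by
    nlinarith [mul_nonneg (sub_nonneg.2 h2α) (sub_nonneg.2 h2β),
      mul_nonneg hi2 (sub_nonneg.2 h2α), mul_nonneg hj2 (sub_nonneg.2 h2β)]
  have g4 : 0 ≤ γ * δ - δ * j4 - γ * i4 := by
    nlinarith [mul_nonneg (sub_nonneg.2 h4γ) (sub_nonneg.2 h4δ),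
      mul_nonneg hi4 (sub_nonneg.2 h4δ), mul_nonneg hj4 (sub_nonneg.2 h4γ)]
  rcases hP.eq_or_lt with h0 | h0
  · have e1 : α = 0 := by linarith
    have e2 : δ = 0 := by linarith
    subst h0
    have e3 : i2 = 0 := by linarith
    have e4 : i4 = 0 := by linarith
    rw [e1, e2, e3, e4]
    linarith
  have hQ : 0 < Q := by linarith
  have hα : 0 ≤ α := by linarith
  have hβ : 0 ≤ β := by linarith
  have hγ : 0 ≤ γ := by linarith
  have hδ : 0 ≤ δ := by linarith
  have a2 : α * β - α * j2 - β * i2 =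
      P * Q * ((α/P) * (β/Q) - (α/P) * (j2/Q) - (β/Q) * (i2/P)) := by field_simp
  have a4 : γ * δ - δ * j4 - γ * i4 =
      P * Q * ((γ/Q) * (δ/P) - (δ/P) * (j4/Q) - (γ/Q) * (i4/P)) := by field_simp
  have as : (β + γ - Q) * (α + δ - P) = P * Q * ((β/Q + γ/Q - 1) * (α/P + δ/P - 1)) := by
    field_simp
  have hPQ0 : 0 < P * Q := by positivity
  have j2' : j2 / Q ≤ j2 / P := div_le_div_of_nonneg_left hj2 h0 hPQ
  have j4' : j4 / Q ≤ j4 / P := div_le_div_of_nonneg_left hj4 h0 hPQ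
  have kk : (i2 + j2 + i4 + j4) / P ≤ 1 := (div_le_one h0).2 hk
  have := core_alg (α/P) (β/Q) (γ/Q) (δ/P) (i2/P) (j2/Q) (i4/P) (j4/Q) (by positivity)
    ((div_le_one h0).2 hα1) (by positivity) ((div_le_one hQ).2 hβ1) (by positivity)
    ((div_le_one hQ).2 hγ1) (by positivity) ((div_le_one h0).2 hδ1) (by positivity)
    (by positivity) (by positivity) (by positivity)
    (by rw [add_div, add_div, add_div] at kk; linarith)
    (by rw [a2] at g2; exact nonneg_of_mul_nonneg_right g2 hPQ0)
    (by rw [a4] at g4; exact nonneg_of_mul_nonneg_right g4 hPQ0)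
    (by
      rcases hs with h | h
      · left; rw [← add_div]; exact (one_le_div hQ).2 h
      · right; rw [← add_div]; exact (one_le_div h0).2 h)
  rw [a2, a4, as]
  nlinarith

open MeasureTheory in
lemma vol_std_tri : (1/2 : ℝ) ≤
    (volume {z : ℝ × ℝ | 0 < z.1 ∧ 0 < z.2 ∧ z.1 + z.2 < 1}).toReal := by
  have h := volume_regionBetween_eq_integral (μ := (volume : Measure ℝ)) (f := fun _ : ℝ => (0:ℝ))
    (g := fun x => 1 - x) (s := Ioo (0:ℝ) 1)
    (by simp) ((by fun_prop : Continuous fun x : ℝ => 1 - x).integrableOn_Icc.mono_set Ioo_subset_Icc_self)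
    measurableSet_Ioo (fun x hx => by have := hx.2; linarith)
  have e : regionBetween (fun _ : ℝ => (0:ℝ)) (fun x => 1 - x) (Ioo (0:ℝ) 1) =
      {z : ℝ × ℝ | 0 < z.1 ∧ 0 < z.2 ∧ z.1 + z.2 < 1} := by
    ext ⟨x, y⟩
    simp only [regionBetween, Set.mem_Ioo, Set.mem_ofPred_eq]
    constructor
    · rintro ⟨⟨h1, h2⟩, h3, h4⟩; exact ⟨h1, h3, by linarith⟩
    · rintro ⟨h1, h2, h3⟩; exact ⟨⟨h1, by linarith⟩, h2, by linarith⟩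
  rw [← e, Measure.volume_eq_prod, h]
  have : ∫ y in Ioo (0:ℝ) 1, ((fun x : ℝ => 1 - x) - fun _ : ℝ => (0:ℝ)) y = 1/2 := by
    rw [← integral_Ioc_eq_integral_Ioo, ← intervalIntegral.integral_of_le zero_le_one]
    simp only [Pi.sub_apply, sub_zero]
    rw [intervalIntegral.integral_sub (by simp) (by simp)]
    simp
    norm_num
  rw [this, ENNReal.toReal_ofReal (by norm_num)]

/-- planar cross product -/
def crs (u v : ℝ × ℝ) : ℝ := u.1 * v.2 - u.2 * v.1

/-- area -/
noncomputable def ar (K : Set (ℝ × ℝ)) : ℝ := (MeasureTheory.volume K).toReal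

lemma det_mk (a b c d : ℝ) : LinearMap.det
    (LinearMap.prod (a • LinearMap.fst ℝ ℝ ℝ + b • LinearMap.snd ℝ ℝ ℝ)
      (c • LinearMap.fst ℝ ℝ ℝ + d • LinearMap.snd ℝ ℝ ℝ)) = a * d - b * c := by
  rw [← LinearMap.det_toMatrix (Module.Basis.finTwoProd ℝ), Matrix.det_fin_two]
  simp [LinearMap.toMatrix_apply]

open MeasureTheory in
lemma ar_linear (a b c d : ℝ) (K : Set (ℝ × ℝ)) :
    ar ((fun z : ℝ × ℝ => (a * z.1 + b * z.2, c * z.1 + d * z.2)) '' K)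
      = |a * d - b * c| * ar K := by
  have := Measure.addHaar_image_linearMap (volume : Measure (ℝ × ℝ))
    (LinearMap.prod (a • LinearMap.fst ℝ ℝ ℝ + b • LinearMap.snd ℝ ℝ ℝ)
      (c • LinearMap.fst ℝ ℝ ℝ + d • LinearMap.snd ℝ ℝ ℝ)) K
  rw [det_mk] at this
  have e : ((fun z : ℝ × ℝ => (a * z.1 + b * z.2, c * z.1 + d * z.2)) '' K) =
    (LinearMap.prod (a • LinearMap.fst ℝ ℝ ℝ + b • LinearMap.snd ℝ ℝ ℝ)
      (c • LinearMap.fst ℝ ℝ ℝ + d • LinearMap.snd ℝ ℝ ℝ)) '' K := by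
    apply Set.image_congr; intro z _; simp
  unfold ar
  rw [e, this, ENNReal.toReal_mul, ENNReal.toReal_ofReal (abs_nonneg _)]

open MeasureTheory in
lemma ar_translate (v : ℝ × ℝ) (K : Set (ℝ × ℝ)) : ar ((fun z => v + z) '' K) = ar K := by
  unfold ar
  rw [Set.image_add_left, measure_preimage_add]

lemma ar_mono {K L : Set (ℝ × ℝ)} (hL : IsCompact L) (h : K ⊆ L) : ar K ≤ ar L :=
  ENNReal.toReal_mono hL.measure_lt_top.ne (MeasureTheory.measure_mono h)

/-- cutting off a triangle -/
lemma cut_step {K : Set (ℝ × ℝ)} (hK : IsCompact K) (hc : Convex ℝ K) {P A B : ℝ × ℝ}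
    (hP : P ∈ K) (hA : A ∈ K) (hB : B ∈ K) (hcr : 0 ≤ crs (A - P) (B - P)) :
    ar (K ∩ {X | crs (A - P) (X - P) ≤ 0}) + crs (A - P) (B - P) / 2 ≤ ar K := by
  rcases hcr.eq_or_lt with h0 | h0
  · rw [← h0]; simp only [zero_div, add_zero]
    exact ar_mono hK Set.inter_subset_left
  set S := {z : ℝ × ℝ | 0 < z.1 ∧ 0 < z.2 ∧ z.1 + z.2 < 1}
  set T := (fun z => P + z) '' ((fun z : ℝ × ℝ => ((A - P).1 * z.1 + (B - P).1 * z.2,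
    (A - P).2 * z.1 + (B - P).2 * z.2)) '' S) with hT
  have hTar : crs (A - P) (B - P) / 2 ≤ ar T := by
    rw [hT, ar_translate, ar_linear]
    have : (A - P).1 * (B - P).2 - (B - P).1 * (A - P).2 = crs (A - P) (B - P) := by
      unfold crs; ring
    rw [this, abs_of_pos h0]
    have := vol_std_tri
    change 1/2 ≤ ar S at this
    nlinarith
  have hTK : T ⊆ K := by
    rintro _ ⟨_, ⟨z, ⟨h1, h2, h3⟩, rfl⟩, rfl⟩
    have := hc.sum_mem (t := Finset.univ) (w := ![1 - z.1 - z.2, z.1, z.2]) (z := ![P, A, B])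
      (by intro i _; fin_cases i <;> simp <;> linarith) (by simp [Fin.sum_univ_three]; ring)
      (by intro i _; fin_cases i <;> simp [*])
    convert this using 1
    simp only [Fin.sum_univ_three]
    ext <;> simp <;> ring
  have hdisj : T ⊆ {X | crs (A - P) (X - P) ≤ 0}ᶜ := by
    rintro _ ⟨_, ⟨z, ⟨h1, h2, h3⟩, rfl⟩, rfl⟩
    simp only [mem_compl_iff, Set.mem_ofPred_eq, not_le]
    have : crs (A - P) (P + ((A - P).1 * z.1 + (B - P).1 * z.2,
      (A - P).2 * z.1 + (B - P).2 * z.2) - P) = z.2 * crs (A - P) (B - P) := by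
      unfold crs; simp; ring
    rw [this]; positivity
  have hmeas : MeasurableSet {X : ℝ × ℝ | crs (A - P) (X - P) ≤ 0} := by
    apply IsClosed.measurableSet
    apply isClosed_le _ continuous_const
    unfold crs; fun_prop
  have hsplit : ar K = ar (K ∩ {X | crs (A - P) (X - P) ≤ 0}) +
      ar (K \ {X | crs (A - P) (X - P) ≤ 0}) := by
    unfold ar
    rw [← ENNReal.toReal_add, MeasureTheory.measure_inter_add_sdiff _ hmeas]
    · exact (lt_of_le_of_lt (MeasureTheory.measure_mono Set.inter_subset_left) hK.measure_lt_top).ne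
    · exact (lt_of_le_of_lt (MeasureTheory.measure_mono Set.sdiff_subset) hK.measure_lt_top).ne
  have : ar T ≤ ar (K \ {X | crs (A - P) (X - P) ≤ 0}) := by
    apply ENNReal.toReal_mono
    · exact (lt_of_le_of_lt (MeasureTheory.measure_mono Set.sdiff_subset) hK.measure_lt_top).ne
    · exact MeasureTheory.measure_mono fun x hx => ⟨hTK hx, hdisj hx⟩
  linarith

lemma crs_convex (V P : ℝ × ℝ) (s : ℝ) : Convex ℝ {X : ℝ × ℝ | crs V (X - P) ≤ s} := by
  intro x hx y hy a b ha hb hab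
  simp only [Set.mem_ofPred_eq] at *
  have : crs V (a • x + b • y - P) = a * crs V (x - P) + b * crs V (y - P) := by
    have : b = 1 - a := by linarith
    subst this
    unfold crs; simp; ring
  rw [this]
  calc _ ≤ a * s + b * s := add_le_add (mul_le_mul_of_nonneg_left hx ha) (mul_le_mul_of_nonneg_left hy hb)
    _ = s := by rw [← add_mul, hab, one_mul]

lemma crs_closed (V P : ℝ × ℝ) (s : ℝ) : IsClosed {X : ℝ × ℝ | crs V (X - P) ≤ s} := by
  apply isClosed_le _ continuous_const
  unfold crs; fun_prop

/-- fan with apex `P` and four... five further points -/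
lemma fan5 {K : Set (ℝ × ℝ)} (hK : IsCompact K) (hc : Convex ℝ K) {P V1 V2 V3 V4 V5 : ℝ × ℝ}
    (hP : P ∈ K) (h1 : V1 ∈ K) (h2 : V2 ∈ K) (h3 : V3 ∈ K) (h4 : V4 ∈ K) (h5 : V5 ∈ K)
    (h12 : 0 ≤ crs (V1 - P) (V2 - P)) (h13 : 0 ≤ crs (V1 - P) (V3 - P))
    (h14 : 0 ≤ crs (V1 - P) (V4 - P))
    (h23 : 0 ≤ crs (V2 - P) (V3 - P)) (h24 : 0 ≤ crs (V2 - P) (V4 - P))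
    (h34 : 0 ≤ crs (V3 - P) (V4 - P)) (h45 : 0 ≤ crs (V4 - P) (V5 - P)) :
    (crs (V1 - P) (V2 - P) + crs (V2 - P) (V3 - P) + crs (V3 - P) (V4 - P)
      + crs (V4 - P) (V5 - P)) / 2 ≤ ar K := by
  have anti : ∀ u v : ℝ × ℝ, crs u v = - crs v u := by intro u v; unfold crs; ring
  have self : ∀ u : ℝ × ℝ, crs u u = 0 := by intro u; unfold crs; ring
  have zer : ∀ u : ℝ × ℝ, crs u 0 = 0 := by intro u; unfold crs; simp
  have s1 := cut_step hK hc hP h4 h5 h45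
  set K1 := K ∩ {X | crs (V4 - P) (X - P) ≤ 0}
  have hK1 : IsCompact K1 := hK.inter_right (crs_closed _ _ _)
  have hc1 : Convex ℝ K1 := hc.inter (crs_convex _ _ _)
  have m1 : ∀ V ∈ K, 0 ≤ crs (V - P) (V4 - P) → V ∈ K1 := fun V hV h =>
    ⟨hV, by simp only [Set.mem_ofPred_eq]; rw [anti]; linarith⟩
  have hP1 : P ∈ K1 := m1 P hP (by simp [crs])
  have s2 := cut_step hK1 hc1 hP1 (m1 V3 h3 h34) (m1 V4 h4 (self _).ge) h34
  set K2 := K1 ∩ {X | crs (V3 - P) (X - P) ≤ 0}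
  have hK2 : IsCompact K2 := hK1.inter_right (crs_closed _ _ _)
  have hc2 : Convex ℝ K2 := hc1.inter (crs_convex _ _ _)
  have m2 : ∀ V ∈ K1, 0 ≤ crs (V - P) (V3 - P) → V ∈ K2 := fun V hV h =>
    ⟨hV, by simp only [Set.mem_ofPred_eq]; rw [anti]; linarith⟩
  have hP2 : P ∈ K2 := m2 P hP1 (by simp [crs])
  have s3 := cut_step hK2 hc2 hP2 (m2 V2 (m1 V2 h2 h24) h23) (m2 V3 (m1 V3 h3 h34) (self _).ge) h23
  set K3 := K2 ∩ {X | crs (V2 - P) (X - P) ≤ 0}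
  have hK3 : IsCompact K3 := hK2.inter_right (crs_closed _ _ _)
  have hc3 : Convex ℝ K3 := hc2.inter (crs_convex _ _ _)
  have m3 : ∀ V ∈ K2, 0 ≤ crs (V - P) (V2 - P) → V ∈ K3 := fun V hV h =>
    ⟨hV, by simp only [Set.mem_ofPred_eq]; rw [anti]; linarith⟩
  have hP3 : P ∈ K3 := m3 P hP2 (by simp [crs])
  have s4 := cut_step hK3 hc3 hP3 (m3 V1 (m2 V1 (m1 V1 h1 h14) h13) h12)
    (m3 V2 (m2 V2 (m1 V2 h2 h24) h23) (self _).ge) h12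
  have : 0 ≤ ar (K3 ∩ {X | crs (V1 - P) (X - P) ≤ 0}) := ENNReal.toReal_nonneg
  linarith

lemma lower_part {K : Set (ℝ × ℝ)} (hK : IsCompact K) (hc : Convex ℝ K)
    (x0 y0 p y b b' g h c r : ℝ)
    (m0 : (x0, y0 + y) ∈ K) (m1 : (x0 + b, y0) ∈ K) (m2 : (x0 + b + b', y0) ∈ K)
    (m3 : (x0 + g, y0 + h) ∈ K) (m4 : (x0 + g + c, y0 + h + c) ∈ K) (m5 : (x0 + p, y0 + r) ∈ K)
    (hy : 0 ≤ y) (hb : 0 ≤ b) (hb' : 0 ≤ b') (hh : 0 ≤ h) (hcc : 0 ≤ c) (hr : 0 ≤ r)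
    (hgp : g + c ≤ p) (hbp : b + b' ≤ p) (hgb : b + b' ≤ g - h) (hgr : p - r ≤ g - h) :
    (y * b' + ((b + b') * (h - y) + y * g) + c * (g - h + y)
      + ((g + c) * (r - y) - p * (h + c - y))) / 2 ≤
    ar (K ∩ {X | p * (X.2 - (y0 + y)) - (r - y) * (X.1 - x0) ≤ 0}) := by
  have hset : {X : ℝ × ℝ | p * (X.2 - (y0 + y)) - (r - y) * (X.1 - x0) ≤ 0} =
      {X | crs ((x0 + p, y0 + r) - (x0, y0 + y)) (X - (x0, y0 + y)) ≤ 0} := by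
    ext X; simp only [Set.mem_ofPred_eq, crs, Prod.fst_sub, Prod.snd_sub]
    ring_nf
  have hbg : b ≤ g := by linarith
  have hg0 : 0 ≤ g := by linarith
  have n1 := mul_nonneg hb hh
  have n2 := mul_nonneg hb' hh
  have n3 := mul_nonneg hy (sub_nonneg.2 hbg)
  have n4 : 0 ≤ y * (g - b - b') := mul_nonneg hy (by linarith)
  have n5 := mul_nonneg hy hb'
  have n6 := mul_nonneg hy hcc
  have n7 := mul_nonneg hb hcc
  have n8 := mul_nonneg hb' hcc
  have n9 := mul_nonneg hb hr
  have n10 := mul_nonneg hb' hr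
  have n11 : 0 ≤ y * (p - b - b') := mul_nonneg hy (by linarith)
  have n12 : 0 ≤ c * (g - h) := mul_nonneg hcc (by linarith)
  have n13 : 0 ≤ y * (p - g - c) := mul_nonneg hy (by linarith)
  have n14 : 0 ≤ (g - h) * (p - g - c) := mul_nonneg (by linarith) (by linarith)
  have n15 : 0 ≤ (g + c) * (r - h - (p - g)) := mul_nonneg (by linarith) (by linarith)
  have n16 : 0 ≤ g * (r - h - (p - g)) := mul_nonneg (by linarith) (by linarith)
  have hcr : ∀ V ∈ K, 0 ≤ crs (V - (x0, y0 + y)) ((x0 + p, y0 + r) - (x0, y0 + y)) → 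
      V ∈ K ∩ {X | p * (X.2 - (y0 + y)) - (r - y) * (X.1 - x0) ≤ 0} := by
    intro V hV h
    rw [hset]
    refine ⟨hV, ?_⟩
    simp only [Set.mem_ofPred_eq, crs] at h ⊢
    linarith
  have hK1 : IsCompact (K ∩ {X | p * (X.2 - (y0 + y)) - (r - y) * (X.1 - x0) ≤ 0}) := by
    rw [hset]; exact hK.inter_right (crs_closed _ _ _)
  have hc1 : Convex ℝ (K ∩ {X | p * (X.2 - (y0 + y)) - (r - y) * (X.1 - x0) ≤ 0}) := by
    rw [hset]; exact hc.inter (crs_convex _ _ _)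
  have := fan5 hK1 hc1 (hcr _ m0 ?_) (hcr _ m1 ?_) (hcr _ m2 ?_) (hcr _ m3 ?_) (hcr _ m4 ?_) (hcr _ m5 ?_)
    ?_ ?_ ?_ ?_ ?_ ?_ ?_
  · refine le_trans (le_of_eq ?_) this
    simp only [crs, Prod.fst_sub, Prod.snd_sub]
    ring
  all_goals simp only [crs, Prod.fst_sub, Prod.snd_sub]
  all_goals ring_nf
  all_goals ring_nf at n1 n2 n3 n4 n5 n6 n7 n8 n9 n10 n11 n12 n13 n14 n15 n16
  all_goals nlinarith

open MeasureTheory in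
lemma line_null (p s x0 y0 e : ℝ) (hp : 0 < p) :
    volume {X : ℝ × ℝ | p * (X.2 - y0) - s * (X.1 - x0) = e} = 0 := by
  have hm : MeasurableSet {X : ℝ × ℝ | p * (X.2 - y0) - s * (X.1 - x0) = e} := by
    apply IsClosed.measurableSet
    apply isClosed_eq <;> fun_prop
  rw [Measure.volume_eq_prod, Measure.measure_prod_null hm]
  filter_upwards with x
  simp only [Pi.zero_apply]
  apply Set.Subsingleton.measure_zero
  intro a ha b hb
  simp only [Set.mem_preimage, Set.mem_ofPred_eq] at ha hb
  have : p * (a - b) = 0 := by linarith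
  rcases mul_eq_zero.1 this with h | h
  · linarith
  · linarith

open MeasureTheory in
/-- split along a line -/
lemma ar_split {K : Set (ℝ × ℝ)} (hK : IsCompact K) (p s x0 y0 e : ℝ) (hp : 0 < p) :
    ar (K ∩ {X | p * (X.2 - y0) - s * (X.1 - x0) ≤ e}) +
    ar (K ∩ {X | e ≤ p * (X.2 - y0) - s * (X.1 - x0)}) ≤ ar K := by
  have hm : MeasurableSet {X : ℝ × ℝ | p * (X.2 - y0) - s * (X.1 - x0) ≤ e} := by
    apply IsClosed.measurableSet
    apply isClosed_le <;> fun_prop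
  have hfin : ∀ S ⊆ K, volume S ≠ ⊤ := fun S hS =>
    (lt_of_le_of_lt (measure_mono hS) hK.measure_lt_top).ne
  have h1 : volume (K ∩ {X | e ≤ p * (X.2 - y0) - s * (X.1 - x0)}) ≤
      volume (K \ {X | p * (X.2 - y0) - s * (X.1 - x0) ≤ e}) := by
    have : K ∩ {X | e ≤ p * (X.2 - y0) - s * (X.1 - x0)} ⊆
      (K \ {X | p * (X.2 - y0) - s * (X.1 - x0) ≤ e}) ∪ {X : ℝ × ℝ | p * (X.2 - y0) - s * (X.1 - x0) = e} := by
      rintro X ⟨hX, h2⟩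
      simp only [Set.mem_ofPred_eq] at h2
      rcases h2.eq_or_lt with h | h
      · right; exact h.symm
      · left; exact ⟨hX, not_le.2 h⟩
    refine (measure_mono this).trans ((measure_union_le _ _).trans ?_)
    rw [line_null p s x0 y0 e hp, add_zero]
  unfold ar
  rw [← ENNReal.toReal_add (hfin _ Set.inter_subset_left) (hfin _ Set.inter_subset_left)]
  apply ENNReal.toReal_mono hK.measure_lt_top.ne
  rw [← measure_inter_add_sdiff K hm]
  gcongr

lemma ar_neg (K : Set (ℝ × ℝ)) : ar ((fun z : ℝ × ℝ => -z) '' K) = ar K := by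
  have := ar_linear (-1) 0 0 (-1) K
  simp only [mul_neg, mul_one, neg_neg, mul_zero, sub_zero, abs_one, one_mul] at this
  rw [← this]
  congr 1
  apply Set.image_congr; intro z _; ext <;> simp

set_option maxHeartbeats 4000000 in
lemma ML {K : Set (ℝ × ℝ)} (hK : IsCompact K) (hc : Convex ℝ K)
    (m a b c x0 x1 y0 y1 yl yr xb xt gx gy ex ey : ℝ)
    (hm : 0 ≤ m) (ha : 0 ≤ a) (hb : 0 ≤ b) (hcc : 0 ≤ c) (hp : x0 < x1)
    (ha' : (a = 0 ∧ m ≤ x1 - x0) ∨ a = m - (x1 - x0))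
    (hb' : (b = 0 ∧ m ≤ y1 - y0) ∨ b = m - (y1 - y0))
    (hc' : (c = 0 ∧ m ≤ (gx - gy) - (ex - ey)) ∨ c = m - ((gx - gy) - (ex - ey)))
    (hpq : x1 - x0 ≤ y1 - y0) (hqw : y1 - y0 ≤ (gx - gy) - (ex - ey))
    (l1 : (x0, yl) ∈ K) (l2 : (x0, yl + a) ∈ K) (r1 : (x1, yr) ∈ K) (r2 : (x1, yr + a) ∈ K)
    (b1 : (xb, y0) ∈ K) (b2 : (xb + b, y0) ∈ K) (t1 : (xt, y1) ∈ K) (t2 : (xt + b, y1) ∈ K)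
    (g1 : (gx, gy) ∈ K) (g2 : (gx + c, gy + c) ∈ K) (e1 : (ex, ey) ∈ K) (e2 : (ex + c, ey + c) ∈ K)
    (hl : y0 ≤ yl) (hl' : yl + a ≤ y1) (hr : y0 ≤ yr) (hr' : yr + a ≤ y1)
    (hbb : x0 ≤ xb) (hbb' : xb + b ≤ x1) (ht : x0 ≤ xt) (ht' : xt + b ≤ x1)
    (hg : y0 ≤ gy) (hg' : gx + c ≤ x1) (he : x0 ≤ ex) (he' : ey + c ≤ y1)
    (hgr : x1 - yr ≤ gx - gy) (hgb : xb + b - y0 ≤ gx - gy)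
    (hel : ex - ey ≤ x0 - (yl + a)) (het : ex - ey ≤ xt - y1)
    (hs : yl ≤ yr ∨ xb ≤ xt) :
    3 / 8 * m ^ 2 ≤ ar K + (a ^ 2 + b ^ 2 + c ^ 2) / 2 := by
  -- lower part
  have low := lower_part hK hc x0 y0 (x1 - x0) (yl - y0) (xb - x0) b (gx - x0) (gy - y0) c (yr - y0)
    (by simpa using l1) (by simpa using b1) (by simpa using b2) (by simpa using g1) (by simpa using g2)
    (by simpa using r1) (by linarith) (by linarith) hb (by linarith) hcc (by linarith) (by linarith)
    (by linarith) (by linarith) (by linarith)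
  have hKn : IsCompact ((fun z : ℝ × ℝ => -z) '' K) := hK.image continuous_neg
  have hcn : Convex ℝ ((fun z : ℝ × ℝ => -z) '' K) := by
    have := hc.neg
    rwa [← Set.image_neg_eq_neg] at this
  have mn : ∀ x y x' y' : ℝ, (x, y) ∈ K → x' = -x → y' = -y → (x', y') ∈ (fun z : ℝ × ℝ => -z) '' K := by
    rintro x y x' y' h rfl rfl
    exact ⟨(x, y), h, rfl⟩
  have upp := lower_part hKn hcn (-x1) (-y1) (x1 - x0) (y1 - yr - a) (x1 - xt - b) b (x1 - (ex + c))
    (y1 - (ey + c)) c (y1 - yl - a)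
    (mn _ _ _ _ r2 (by ring) (by ring)) (mn _ _ _ _ t2 (by ring) (by ring))
    (mn _ _ _ _ t1 (by ring) (by ring)) (mn _ _ _ _ e2 (by ring) (by ring))
    (mn _ _ _ _ e1 (by ring) (by ring)) (mn _ _ _ _ l2 (by ring) (by ring))
    (by linarith) (by linarith) hb (by linarith) hcc (by linarith) (by linarith)
    (by linarith) (by linarith) (by linarith)
  have hup : (fun z : ℝ × ℝ => -z) '' K ∩ {X | (x1 - x0) * (X.2 - (-y1 + (y1 - yr - a))) -
      (y1 - yl - a - (y1 - yr - a)) * (X.1 - -x1) ≤ 0} =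
      (fun z : ℝ × ℝ => -z) '' (K ∩ {X | (x1 - x0) * a ≤
        (x1 - x0) * (X.2 - yl) - (yr - yl) * (X.1 - x0)}) := by
    ext X
    constructor
    · rintro ⟨⟨Z, hZ, rfl⟩, h⟩
      refine ⟨Z, ⟨hZ, ?_⟩, rfl⟩
      simp only [Set.mem_ofPred_eq, Prod.fst_neg, Prod.snd_neg] at h ⊢
      linarith
    · rintro ⟨Z, ⟨hZ, h⟩, rfl⟩
      refine ⟨⟨Z, hZ, rfl⟩, ?_⟩
      simp only [Set.mem_ofPred_eq, Prod.fst_neg, Prod.snd_neg] at h ⊢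
      linarith
  rw [hup, ar_neg] at upp
  have hlo : {X : ℝ × ℝ | (x1 - x0) * (X.2 - (y0 + (yl - y0))) -
      (yr - y0 - (yl - y0)) * (X.1 - x0) ≤ 0} = 
      {X : ℝ × ℝ | (x1 - x0) * (X.2 - yl) - (yr - yl) * (X.1 - x0) ≤ 0} := by
    ext X; simp only [Set.mem_ofPred_eq]; ring_nf
  rw [hlo] at low
  have sp1 := ar_split hK (x1 - x0) (yr - yl) x0 yl 0 (by linarith)
  have hsetc : ∀ e : ℝ, {X : ℝ × ℝ | e ≤ (x1 - x0) * (X.2 - yl) - (yr - yl) * (X.1 - x0)} =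
      {X | crs (-(x1 - x0), -(yr - yl)) (X - (x0, yl)) ≤ -e} := by
    intro e
    ext X; simp only [Set.mem_ofPred_eq, crs, Prod.fst_sub, Prod.snd_sub]
    constructor <;> intro h <;> linarith
  have hsetd : ∀ e : ℝ, {X : ℝ × ℝ | (x1 - x0) * (X.2 - yl) - (yr - yl) * (X.1 - x0) ≤ e} =
      {X | crs ((x1 - x0), (yr - yl)) (X - (x0, yl)) ≤ e} := by
    intro e
    ext X; simp only [Set.mem_ofPred_eq, crs, Prod.fst_sub, Prod.snd_sub]
  set K1 := K ∩ {X | 0 ≤ (x1 - x0) * (X.2 - yl) - (yr - yl) * (X.1 - x0)} with hK1d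
  have hK1 : IsCompact K1 := by
    rw [hK1d, hsetc]; exact hK.inter_right (crs_closed _ _ _)
  have hc1 : Convex ℝ K1 := by
    rw [hK1d, hsetc]; exact hc.inter (crs_convex _ _ _)
  have sp2 := ar_split hK1 (x1 - x0) (yr - yl) x0 yl ((x1 - x0) * a) (by linarith)
  have hpa : 0 ≤ (x1 - x0) * a := mul_nonneg (by linarith) ha
  have hupm : ar (K ∩ {X | (x1 - x0) * a ≤ (x1 - x0) * (X.2 - yl) - (yr - yl) * (X.1 - x0)}) ≤
      ar (K1 ∩ {X | (x1 - x0) * a ≤ (x1 - x0) * (X.2 - yl) - (yr - yl) * (X.1 - x0)}) := by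
    apply le_of_eq; congr 1
    ext X
    simp only [hK1d, Set.mem_inter_iff, Set.mem_ofPred_eq]
    constructor
    · rintro ⟨h1, h2⟩; exact ⟨⟨h1, by linarith⟩, h2⟩
    · rintro ⟨⟨h1, _⟩, h2⟩; exact ⟨h1, h2⟩
  have mid : (x1 - x0) * a ≤ ar (K1 ∩ {X | (x1 - x0) * (X.2 - yl) - (yr - yl) * (X.1 - x0)
      ≤ (x1 - x0) * a}) := by
    have hK2 : IsCompact (K1 ∩ {X | (x1 - x0) * (X.2 - yl) - (yr - yl) * (X.1 - x0)
      ≤ (x1 - x0) * a}) := by rw [hsetd]; exact hK1.inter_right (crs_closed _ _ _)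
    have hc2 : Convex ℝ (K1 ∩ {X | (x1 - x0) * (X.2 - yl) - (yr - yl) * (X.1 - x0)
      ≤ (x1 - x0) * a}) := by rw [hsetd]; exact hc1.inter (crs_convex _ _ _)
    have mm : ∀ x y : ℝ, (x, y) ∈ K → 0 ≤ (x1 - x0) * (y - yl) - (yr - yl) * (x - x0) →
       (x1 - x0) * (y - yl) - (yr - yl) * (x - x0) ≤ (x1 - x0) * a →
       (x, y) ∈ (K1 ∩ {X | (x1 - x0) * (X.2 - yl) - (yr - yl) * (X.1 - x0)
          ≤ (x1 - x0) * a}) := fun x y h1 h2 h3 => ⟨⟨h1, h2⟩, h3⟩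
    have R := mm _ _ r1 (by linarith) (by linarith)
    have := fan5 hK2 hc2 (mm _ _ l1 (by linarith) (by linarith)) R R R
      (mm _ _ r2 (by linarith) (by linarith)) (mm _ _ l2 (by linarith) (by linarith))
      (by simp only [crs, Prod.fst_sub, Prod.snd_sub]; linarith)
      (by simp only [crs, Prod.fst_sub, Prod.snd_sub]; linarith)
      (by simp only [crs, Prod.fst_sub, Prod.snd_sub]; linarith)
      (by simp only [crs, Prod.fst_sub, Prod.snd_sub]; linarith)
      (by simp only [crs, Prod.fst_sub, Prod.snd_sub]; linarith)
      (by simp only [crs, Prod.fst_sub, Prod.snd_sub]; linarith)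
      (by simp only [crs, Prod.fst_sub, Prod.snd_sub]; linarith)
    refine le_trans (le_of_eq ?_) this
    simp only [crs, Prod.fst_sub, Prod.snd_sub]
    ring
  -- facts on sizes
  have A0 : 0 ≤ (x1 - x0) - b - c := by linarith
  have c1 : (x1 - x0) - b - c ≤ (y1 - y0) - a - c := by
    rcases ha' with ⟨h, h'⟩ | h <;> rcases hb' with ⟨k, k'⟩ | k <;> linarith
  have ksum : (ex - x0) + (y1 - ey - c) + (x1 - gx - c) + (gy - y0) ≤ (x1 - x0) - b - c := by
    rcases hb' with ⟨k, k'⟩ | k <;> rcases hc' with ⟨k2, k2'⟩ | k2 <;> linarith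
  have core := core_scaled ((x1 - x0) - b - c) ((y1 - y0) - a - c) (xt - x0 - c)
    (y1 - yl - a - c) (yr - y0 - c) (x1 - xb - b - c) (ex - x0) (y1 - ey - c) (x1 - gx - c) (gy - y0)
    A0 c1 (by linarith) (by linarith) (by linarith) (by linarith) (by linarith) (by linarith)
    (by linarith) (by linarith) ksum (by linarith) (by linarith) (by linarith) (by linarith)
    (by
      rcases hc' with ⟨k2, k2'⟩ | k2
      · rcases hs with h | h
        · left; linarith
        · right; linarith
      · rcases hcc.eq_or_lt with h0 | h0
        · rcases hs with h | h
          · left; linarith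
          · right; linarith
        · right
          rcases ha' with ⟨h, h'⟩ | h <;> rcases hb' with ⟨k, k'⟩ | k <;> linarith)
  set P := (x1 - x0) - b - c with hPd
  set Q := (y1 - y0) - a - c with hQd
  set W := (gx - gy) - (ex - ey) - a - b with hW
  set d := m - a - b - c with hd
  have dP : d ≤ P := by rcases ha' with ⟨h, h'⟩ | h <;> linarith
  have dW : d ≤ W := by rcases hc' with ⟨h, h'⟩ | h <;> linarith
  have d0 : 0 ≤ d := by
    rcases ha' with ⟨h, h'⟩ | h <;> rcases hb' with ⟨k, k'⟩ | k <;>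
      rcases hc' with ⟨k2, k2'⟩ | k2 <;> linarith
  have tot : 3 / 8 * (P * Q) + a * P + b * Q + c * W + (a * b + b * c + c * a) ≤ ar K := by
    have hlin := add_le_add (add_le_add low mid) upp
    have : 3 / 8 * (P * Q) + a * P + b * Q + c * W + (a * b + b * c + c * a) ≤ 
      ((yl - y0) * b + ((xb - x0 + b) * (gy - y0 - (yl - y0)) + (yl - y0) * (gx - x0)) +
            c * (gx - x0 - (gy - y0) + (yl - y0)) +
          ((gx - x0 + c) * (yr - y0 - (yl - y0)) - (x1 - x0) * (gy - y0 + c - (yl - y0)))) / 2 +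
        (x1 - x0) * a +
      ((y1 - yr - a) * b + ((x1 - xt - b + b) * (y1 - (ey + c) - (y1 - yr - a)) +
              (y1 - yr - a) * (x1 - (ex + c))) +
            c * (x1 - (ex + c) - (y1 - (ey + c)) + (y1 - yr - a)) +
          ((x1 - (ex + c) + c) * (y1 - yl - a - (y1 - yr - a)) -
            (x1 - x0) * (y1 - (ey + c) + c - (y1 - yr - a)))) / 2 := by
      rw [hPd, hQd] at *
      rw [hW]
      linarith
    linarith
  have q1 : d * d ≤ P * Q := mul_le_mul dP (dP.trans c1) d0 A0
  have q2 : a * d ≤ a * P := mul_le_mul_of_nonneg_left dP ha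
  have q3 : b * d ≤ b * Q := mul_le_mul_of_nonneg_left (dP.trans c1) hb
  have q4 : c * d ≤ c * W := mul_le_mul_of_nonneg_left dW hcc
  have hmd : m = d + (a + b + c) := by rw [hd]; ring
  have q5 : 0 ≤ (a + b + c) * d := mul_nonneg (by linarith) d0
  rw [hmd]
  nlinarith [sq_nonneg (a + b + c)]

lemma zdot_neg_left (u p : ℤ × ℤ) : zdot (-u) p = - zdot u p := by simp [zdot]; ring
lemma zdot_sub_left (u v p : ℤ × ℤ) : zdot (u - v) p = zdot u p - zdot v p := by simp [zdot]; ring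
lemma zdot_add_left (u v p : ℤ × ℤ) : zdot (u + v) p = zdot u p + zdot v p := by simp [zdot]; ring

lemma width_eq (u : ℤ × ℤ) (B : Finset (ℤ × ℤ)) (h : B.Nonempty) (s t : ℤ)
    (hb : ∀ X ∈ B, s ≤ zdot u X ∧ zdot u X ≤ t) (hs : ∃ X ∈ B, zdot u X = s)
    (ht : ∃ X ∈ B, zdot u X = t) : widthZ u B h = t - s := by
  have h1 : B.sup' h (zdot u) = t := by
    apply le_antisymm
    · exact Finset.sup'_le _ _ fun X hX => (hb X hX).2
    · obtain ⟨X, hX, rfl⟩ := ht; exact Finset.le_sup' (zdot u) hX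
  have h2 : B.inf' h (zdot u) = s := by
    apply le_antisymm
    · obtain ⟨X, hX, rfl⟩ := hs; exact Finset.inf'_le (zdot u) hX
    · exact Finset.le_inf' _ _ fun X hX => (hb X hX).1
  rw [widthZ, h1, h2]

lemma width_bounds (u : ℤ × ℤ) (B : Finset (ℤ × ℤ)) (h : B.Nonempty) :
    (∀ X ∈ B, B.inf' h (zdot u) ≤ zdot u X ∧ zdot u X ≤ B.sup' h (zdot u)) ∧
    (∃ X ∈ B, zdot u X = B.inf' h (zdot u)) ∧ (∃ X ∈ B, zdot u X = B.sup' h (zdot u)) := by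
  refine ⟨fun X hX => ⟨Finset.inf'_le _ hX, Finset.le_sup' (zdot u) hX⟩, ?_, ?_⟩
  · obtain ⟨X, hX, e⟩ := Finset.exists_mem_eq_inf' h (zdot u); exact ⟨X, hX, e.symm⟩
  · obtain ⟨X, hX, e⟩ := Finset.exists_mem_eq_sup' h (zdot u); exact ⟨X, hX, e.symm⟩

lemma width_neg (u : ℤ × ℤ) (B : Finset (ℤ × ℤ)) (h : B.Nonempty) :
    widthZ (-u) B h = widthZ u B h := by
  obtain ⟨h1, ⟨X, hX, eX⟩, ⟨Y, hY, eY⟩⟩ := width_bounds u B h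
  rw [width_eq (-u) B h (-B.sup' h (zdot u)) (-B.inf' h (zdot u))]
  · unfold widthZ; ring
  · intro X hX; rw [zdot_neg_left]; have := h1 X hX; omega
  · exact ⟨Y, hY, by rw [zdot_neg_left, eY]⟩
  · exact ⟨X, hX, by rw [zdot_neg_left, eX]⟩

lemma width_ge (u : ℤ × ℤ) (B : Finset (ℤ × ℤ)) (h : B.Nonempty) {X Y : ℤ × ℤ} (hX : X ∈ B)
    (hY : Y ∈ B) : |zdot u X - zdot u Y| ≤ widthZ u B h := by
  obtain ⟨h1, -, -⟩ := width_bounds u B h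
  have a := h1 X hX; have b := h1 Y hY
  unfold widthZ
  rw [abs_le]; omega

lemma defect_neg (m : ℕ) (u : ℤ × ℤ) (B : Finset (ℤ × ℤ)) (h : B.Nonempty) :
    defect m (-u) B h = defect m u B h := by
  unfold defect; rw [width_neg]

lemma exists_cross (B : Finset (ℤ × ℤ)) (h : B.Nonempty)
    (h2dim : ¬ Collinear ℝ (toR '' (B : Set (ℤ × ℤ)))) :
    ∃ X ∈ B, ∃ Y ∈ B, ∃ Z ∈ B,
      (Y.1 - X.1) * (Z.2 - X.2) - (Y.2 - X.2) * (Z.1 - X.1) ≠ 0 := by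
  by_contra hcon
  push Not at hcon
  apply h2dim
  obtain ⟨X, hX⟩ := h
  rw [collinear_iff_of_mem (k := ℝ) (show toR X ∈ toR '' (B : Set (ℤ × ℤ)) from ⟨X, hX, rfl⟩)]
  by_cases hall : ∀ Y ∈ B, Y = X
  · refine ⟨0, ?_⟩
    rintro _ ⟨Y, hY, rfl⟩
    exact ⟨0, by rw [hall Y hY]; simp⟩
  · push Not at hall
    obtain ⟨Y, hY, hne⟩ := hall
    refine ⟨toR Y - toR X, ?_⟩
    rintro _ ⟨Z, hZ, rfl⟩
    have hc := hcon X hX Y hY Z hZ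
    have hc' : ((Y.1:ℝ) - X.1) * (Z.2 - X.2) - (Y.2 - X.2) * (Z.1 - X.1) = 0 := by exact_mod_cast hc
    by_cases h1 : Y.1 = X.1
    · have h2 : Y.2 ≠ X.2 := fun h => hne (Prod.ext h1 h)
      have h2' : (Y.2 : ℝ) - X.2 ≠ 0 := by
        intro h; apply h2; exact_mod_cast sub_eq_zero.1 h
      refine ⟨((Z.2:ℝ) - X.2) / (Y.2 - X.2), ?_⟩
      ext
      · simp only [toR, vadd_eq_add, Prod.fst_add, Prod.smul_fst, Prod.fst_sub, smul_eq_mul]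
        field_simp; linarith
      · simp only [toR, vadd_eq_add, Prod.snd_add, Prod.smul_snd, Prod.snd_sub, smul_eq_mul]
        field_simp; linarith
    · have h2' : (Y.1 : ℝ) - X.1 ≠ 0 := by
        intro h; apply h1; exact_mod_cast sub_eq_zero.1 h
      refine ⟨((Z.1:ℝ) - X.1) / (Y.1 - X.1), ?_⟩
      ext
      · simp only [toR, vadd_eq_add, Prod.fst_add, Prod.smul_fst, Prod.fst_sub, smul_eq_mul]
        field_simp; linarith
      · simp only [toR, vadd_eq_add, Prod.snd_add, Prod.smul_snd, Prod.snd_sub, smul_eq_mul]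
        field_simp; linarith

/-- Directions are determined by their values on two independent vectors. -/
lemma dir_inj (X Y Z u v : ℤ × ℤ)
    (hne : (Y.1 - X.1) * (Z.2 - X.2) - (Y.2 - X.2) * (Z.1 - X.1) ≠ 0)
    (h1 : zdot u Y - zdot u X = zdot v Y - zdot v X)
    (h2 : zdot u Z - zdot u X = zdot v Z - zdot v X) : u = v := by
  unfold zdot at h1 h2
  ext
  · apply sub_eq_zero.1
    apply (mul_eq_zero.1 (_ : (u.1 - v.1) * ((Y.1 - X.1) * (Z.2 - X.2) - (Y.2 - X.2) * (Z.1 - X.1)) = 0)).resolve_right hne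
    linear_combination (Z.2 - X.2) * h1 - (Y.2 - X.2) * h2
  · apply sub_eq_zero.1
    apply (mul_eq_zero.1 (_ : (u.2 - v.2) * ((Y.1 - X.1) * (Z.2 - X.2) - (Y.2 - X.2) * (Z.1 - X.1)) = 0)).resolve_right hne
    linear_combination (Y.1 - X.1) * h2 - (Z.1 - X.1) * h1

lemma width_pos (B : Finset (ℤ × ℤ)) (h : B.Nonempty)
    (h2dim : ¬ Collinear ℝ (toR '' (B : Set (ℤ × ℤ)))) (u : ℤ × ℤ) (hu : u ≠ 0) :
    0 < widthZ u B h := by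
  obtain ⟨X, hX, Y, hY, Z, hZ, hne⟩ := exists_cross B h h2dim
  by_contra hcon
  have a := width_ge u B h hY hX
  have b := width_ge u B h hZ hX
  rw [abs_le] at a b
  apply hu
  apply dir_inj X Y Z u 0 hne
  · simp [zdot] at *; omega
  · simp [zdot] at *; omega

lemma finite_defect (m : ℕ) (B : Finset (ℤ × ℤ)) (h : B.Nonempty)
    (h2dim : ¬ Collinear ℝ (toR '' (B : Set (ℤ × ℤ)))) :
    {u : ℤ × ℤ | defect m u B h ≠ 0}.Finite := by
  obtain ⟨X, hX, Y, hY, Z, hZ, hne⟩ := exists_cross B h h2dim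
  apply Set.Finite.of_finite_image (f := fun u => (zdot u Y - zdot u X, zdot u Z - zdot u X))
  · apply (Set.finite_Icc ((-m, -m) : ℤ × ℤ) (m, m)).subset
    rintro _ ⟨u, hu, rfl⟩
    simp only [Set.mem_ofPred_eq, defect] at hu
    have a := width_ge u B h hY hX
    have b := width_ge u B h hZ hX
    rw [abs_le] at a b
    have : widthZ u B h ≤ m := by
      by_contra hc
      apply hu
      apply max_eq_right; omega
    simp only [Set.mem_Icc, Prod.mk_le_mk]
    omega
  · intro u _ v _ huv
    simp only [Prod.mk.injEq] at huv
    exact dir_inj X Y Z u v hne huv.1 huv.2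

lemma side_points (B : Finset (ℤ × ℤ)) (hconv : latticeHull B = (B : Set (ℤ × ℤ)))
    (u v : ℤ × ℤ) (hdet : (u.1 * v.2 - u.2 * v.1) ^ 2 = 1) (s a : ℤ) (ha : 0 ≤ a)
    (hcard : a + 1 ≤ (({p ∈ latticeHull B | zdot u p = s} : Set (ℤ × ℤ)).ncard : ℤ)) :
    ∃ X ∈ B, ∃ X' ∈ B, zdot u X = s ∧ zdot u X' = s ∧ zdot v X' = zdot v X + a := by
  classical
  have hF : ({p ∈ latticeHull B | zdot u p = s} : Set (ℤ × ℤ)) =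
      ((B.filter fun p => zdot u p = s : Finset (ℤ × ℤ)) : Set (ℤ × ℤ)) := by
    rw [hconv]; ext p; simp
  rw [hF, Set.ncard_coe_finset] at hcard
  set F := B.filter fun p => zdot u p = s
  have solve : ∀ X Y : ℤ × ℤ, zdot u X = s → zdot u Y = s →
      Y.1 - X.1 = (zdot v Y - zdot v X) * ((u.1 * v.2 - u.2 * v.1) * (-u.2)) ∧
      Y.2 - X.2 = (zdot v Y - zdot v X) * ((u.1 * v.2 - u.2 * v.1) * u.1) := by
    intro X Y hX hY
    unfold zdot at *
    constructor
    · linear_combination -(Y.1 - X.1) * hdet + (u.1 * v.2 - u.2 * v.1) * v.2 * (hY - hX)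
    · linear_combination -(Y.2 - X.2) * hdet - (u.1 * v.2 - u.2 * v.1) * v.1 * (hY - hX)
  have hinj : Set.InjOn (zdot v) (F : Set (ℤ × ℤ)) := by
    intro X hX Y hY e
    simp only [F, Finset.coe_filter, Set.mem_ofPred_eq] at hX hY
    have := solve X Y hX.2 hY.2
    rw [e] at this
    simp only [sub_self, zero_mul] at this
    ext <;> omega
  have hne : F.Nonempty := by
    rw [← Finset.card_pos]; omega
  have hGne : (F.image (zdot v)).Nonempty := hne.image _
  have hGc : (F.image (zdot v)).card = F.card := Finset.card_image_of_injOn hinj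
  obtain ⟨X, hX, eX⟩ := Finset.mem_image.1 ((F.image (zdot v)).min'_mem hGne)
  obtain ⟨Y, hY, eY⟩ := Finset.mem_image.1 ((F.image (zdot v)).max'_mem hGne)
  have hsub : F.image (zdot v) ⊆ Finset.Icc (zdot v X) (zdot v Y) := by
    intro z hz
    rw [Finset.mem_Icc, eX, eY]
    exact ⟨Finset.min'_le _ _ hz, Finset.le_max' _ _ hz⟩
  have hc2 := Finset.card_le_card hsub
  rw [hGc, Int.card_Icc] at hc2
  have hgap : a ≤ zdot v Y - zdot v X := by omega
  simp only [F, Finset.mem_filter] at hX hY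
  obtain ⟨d1, d2⟩ := solve X Y hX.2 hY.2
  set e := u.1 * v.2 - u.2 * v.1 with he
  refine ⟨X, hX.1, (X.1 + a * (e * (-u.2)), X.2 + a * (e * u.1)), ?_, hX.2, ?_, ?_⟩
  · rw [← Finset.mem_coe, ← hconv]
    change toR _ ∈ convexHull ℝ _
    rcases ha.eq_or_lt with h0 | h0
    · have : ((X.1 + a * (e * (-u.2)), X.2 + a * (e * u.1)) : ℤ × ℤ) = X := by
        rw [← h0]; simp
      rw [this]
      exact subset_convexHull _ _ ⟨X, hX.1, rfl⟩
    · set L := zdot v Y - zdot v X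
      have hL : (0:ℝ) < L := by exact_mod_cast h0.trans_le hgap
      have := (convex_convexHull ℝ (toR '' (B : Set (ℤ × ℤ)))).add_smul_sub_mem
        (subset_convexHull _ _ ⟨X, hX.1, rfl⟩) (subset_convexHull _ _ ⟨Y, hY.1, rfl⟩)
        (t := (a : ℝ) / L) ⟨by positivity, (div_le_one hL).2 (by exact_mod_cast hgap)⟩
      convert this using 1
      have d1' : (Y.1 : ℝ) - X.1 = L * (e * (-u.2)) := by exact_mod_cast d1
      have d2' : (Y.2 : ℝ) - X.2 = L * (e * u.1) := by exact_mod_cast d2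
      ext
      · simp only [toR, Prod.fst_add, Prod.smul_fst, Prod.fst_sub, smul_eq_mul, d1']
        push_cast; field_simp
      · simp only [toR, Prod.snd_add, Prod.smul_snd, Prod.snd_sub, smul_eq_mul, d2']
        push_cast; field_simp
  · rw [← hX.2]; simp only [zdot]; ring
  · simp only [zdot]; linear_combination a * hdet

def ThickCond (m : ℕ) (B : Finset (ℤ × ℤ)) (h : B.Nonempty) : Prop :=
  ∀ u : ℤ × ℤ, u ≠ 0 → ∀ a : ℤ, 0 < a → widthZ u B h = (m : ℤ) - a →
      a + 1 ≤ ((maxFace u B h).ncard : ℤ) ∧ a + 1 ≤ ((minFace u B h).ncard : ℤ)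

lemma face_points (m : ℕ) (B : Finset (ℤ × ℤ)) (h : B.Nonempty)
    (hconv : latticeHull B = (B : Set (ℤ × ℤ))) (hth : ThickCond m B h)
    (u v : ℤ × ℤ) (hdet : (u.1 * v.2 - u.2 * v.1) ^ 2 = 1) :
    (∃ X ∈ B, ∃ X' ∈ B, zdot u X = B.sup' h (zdot u) ∧ zdot u X' = B.sup' h (zdot u) ∧
      zdot v X' = zdot v X + defect m u B h) ∧
    (∃ X ∈ B, ∃ X' ∈ B, zdot u X = B.inf' h (zdot u) ∧ zdot u X' = B.inf' h (zdot u) ∧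
      zdot v X' = zdot v X + defect m u B h) := by
  have hu : u ≠ 0 := by rintro rfl; simp at hdet
  have hd : 0 ≤ defect m u B h := le_max_right _ _
  rcases hd.eq_or_lt with h0 | h0
  · obtain ⟨-, ⟨X, hX, eX⟩, ⟨Y, hY, eY⟩⟩ := width_bounds u B h
    rw [← h0]
    exact ⟨⟨Y, hY, Y, hY, eY, eY, by simp⟩, ⟨X, hX, X, hX, eX, eX, by simp⟩⟩
  · have hw : widthZ u B h = (m : ℤ) - defect m u B h := by
      unfold defect at h0 ⊢
      rcases lt_max_iff.1 h0 with h1 | h1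
      · rw [max_eq_left h1.le]; ring
      · omega
    obtain ⟨c1, c2⟩ := hth u hu _ h0 hw
    exact ⟨side_points B hconv u v hdet _ _ hd c1, side_points B hconv u v hdet _ _ hd c2⟩

lemma defect_cases (m : ℕ) (u : ℤ × ℤ) (B : Finset (ℤ × ℤ)) (h : B.Nonempty) (w : ℤ)
    (hw : widthZ u B h = w) : ((defect m u B h : ℝ) = 0 ∧ (m : ℝ) ≤ (w : ℝ)) ∨
      (defect m u B h : ℝ) = m - w := by
  unfold defect; rw [hw]
  rcases le_total ((m : ℤ) - w) 0 with h1 | h1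
  · left; rw [max_eq_right h1]; exact ⟨by simp, by exact_mod_cast sub_nonpos.1 h1⟩
  · right; rw [max_eq_left h1]; push_cast; ring

set_option maxHeartbeats 1000000 in
lemma step_lemma (m : ℕ) (B : Finset (ℤ × ℤ)) (h : B.Nonempty)
    (hconv : latticeHull B = (B : Set (ℤ × ℤ))) (hth : ThickCond m B h)
    (u1 u2 : ℤ × ℤ) (hdet : (u1.1 * u2.2 - u1.2 * u2.1) ^ 2 = 1)
    (x0 x1 y0 y1 yl yr xb xt : ℤ)
    (hx : ∀ X ∈ B, x0 ≤ zdot u1 X ∧ zdot u1 X ≤ x1)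
    (hy : ∀ X ∈ B, y0 ≤ zdot u2 X ∧ zdot u2 X ≤ y1)
    (l1 : ∃ X ∈ B, zdot u1 X = x0 ∧ zdot u2 X = yl)
    (l2 : ∃ X ∈ B, zdot u1 X = x0 ∧ zdot u2 X = yl + defect m u1 B h)
    (r1 : ∃ X ∈ B, zdot u1 X = x1 ∧ zdot u2 X = yr)
    (r2 : ∃ X ∈ B, zdot u1 X = x1 ∧ zdot u2 X = yr + defect m u1 B h)
    (b1 : ∃ X ∈ B, zdot u1 X = xb ∧ zdot u2 X = y0)
    (b2 : ∃ X ∈ B, zdot u1 X = xb + defect m u2 B h ∧ zdot u2 X = y0)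
    (t1 : ∃ X ∈ B, zdot u1 X = xt ∧ zdot u2 X = y1)
    (t2 : ∃ X ∈ B, zdot u1 X = xt + defect m u2 B h ∧ zdot u2 X = y1)
    (hp : x0 < x1) (hpq : x1 - x0 ≤ y1 - y0) (hqw : y1 - y0 ≤ widthZ (u1 - u2) B h)
    (hs : yl ≤ yr ∨ xb ≤ xt) :
    (3 / 8 : ℝ) * (m : ℝ) ^ 2 ≤ areaOf B + ((defect m u1 B h : ℝ) ^ 2 + (defect m u2 B h : ℝ) ^ 2
      + (defect m (u1 - u2) B h : ℝ) ^ 2) / 2 := by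
  have hw1 : widthZ u1 B h = x1 - x0 := by
    obtain ⟨X, hX, e, -⟩ := l1
    obtain ⟨Y, hY, e', -⟩ := r1
    exact width_eq u1 B h _ _ hx ⟨X, hX, e⟩ ⟨Y, hY, e'⟩
  have hw2 : widthZ u2 B h = y1 - y0 := by
    obtain ⟨X, hX, -, e⟩ := b1
    obtain ⟨Y, hY, -, e'⟩ := t1
    exact width_eq u2 B h _ _ hy ⟨X, hX, e⟩ ⟨Y, hY, e'⟩
  have hdet3 : ((u1 - u2).1 * u2.2 - (u1 - u2).2 * u2.1) ^ 2 = 1 := by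
    rw [← hdet]; simp only [Prod.fst_sub, Prod.snd_sub]; ring
  obtain ⟨⟨G, hG, G', hG', eG, eG', dG⟩, ⟨E, hE, E', hE', eE, eE', dE⟩⟩ :=
    face_points m B h hconv hth (u1 - u2) u2 hdet3
  have hw3 : widthZ (u1 - u2) B h = (zdot u1 G - zdot u2 G) - (zdot u1 E - zdot u2 E) := by
    rw [← zdot_sub_left, ← zdot_sub_left, eG, eE]; rfl
  have hd : ∀ X ∈ B, zdot u1 E - zdot u2 E ≤ zdot u1 X - zdot u2 X ∧
      zdot u1 X - zdot u2 X ≤ zdot u1 G - zdot u2 G := by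
    intro X hX
    have := (width_bounds (u1 - u2) B h).1 X hX
    rw [← eG, ← eE, zdot_sub_left, zdot_sub_left, zdot_sub_left] at this
    exact this
  rw [← eG, zdot_sub_left, zdot_sub_left] at eG'
  rw [← eE, zdot_sub_left, zdot_sub_left] at eE'
  set a := defect m u1 B h with ha
  set b := defect m u2 B h with hb
  set c := defect m (u1 - u2) B h with hc
  have ha0 : 0 ≤ a := le_max_right _ _
  have hb0 : 0 ≤ b := le_max_right _ _
  have hc0 : 0 ≤ c := le_max_right _ _
  -- the image
  set K := convexHull ℝ (toR '' (B : Set (ℤ × ℤ))) with hKd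
  have hK : IsCompact K := (B.finite_toSet.image toR).isCompact_convexHull ℝ
  set φ : ℝ × ℝ → ℝ × ℝ := fun z => ((u1.1 : ℝ) * z.1 + (u1.2 : ℝ) * z.2,
    (u2.1 : ℝ) * z.1 + (u2.2 : ℝ) * z.2) with hφ
  have har : ar (φ '' K) = areaOf B := by
    have h1 := ar_linear u1.1 u1.2 u2.1 u2.2 K
    have h2 : |(u1.1 : ℝ) * u2.2 - u1.2 * u2.1| = 1 := by
      have : ((u1.1 : ℝ) * u2.2 - u1.2 * u2.1) ^ 2 = 1 := by exact_mod_cast hdet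
      rw [← sq_abs] at this
      exact (pow_eq_one_iff_of_nonneg (abs_nonneg _) two_ne_zero).1 this
    rw [h2, one_mul] at h1
    exact h1
  have hKi : IsCompact (φ '' K) := hK.image (by fun_prop)
  have hKc : Convex ℝ (φ '' K) := by
    have hK2 : Convex ℝ K := convex_convexHull ℝ _
    rintro _ ⟨x, hx, rfl⟩ _ ⟨y, hy, rfl⟩ α β hα hβ hαβ
    refine ⟨α • x + β • y, hK2 hx hy hα hβ hαβ, ?_⟩
    ext <;> simp [hφ] <;> ring
  have mem : ∀ s t : ℤ, (∃ X ∈ B, zdot u1 X = s ∧ zdot u2 X = t) → ((s : ℝ), (t : ℝ)) ∈ φ '' K := by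
    rintro s t ⟨X, hX, rfl, rfl⟩
    refine ⟨toR X, subset_convexHull _ _ ⟨X, hX, rfl⟩, ?_⟩
    ext <;> simp [hφ, toR, zdot]
  have bd : ∀ s t : ℤ, (∃ X ∈ B, zdot u1 X = s ∧ zdot u2 X = t) →
      x0 ≤ s ∧ s ≤ x1 ∧ y0 ≤ t ∧ t ≤ y1 ∧ zdot u1 E - zdot u2 E ≤ s - t ∧
        s - t ≤ zdot u1 G - zdot u2 G := by
    rintro s t ⟨X, hX, rfl, rfl⟩
    exact ⟨(hx X hX).1, (hx X hX).2, (hy X hX).1, (hy X hX).2, (hd X hX).1, (hd X hX).2⟩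
  have g1 : ∃ X ∈ B, zdot u1 X = zdot u1 G ∧ zdot u2 X = zdot u2 G := ⟨G, hG, rfl, rfl⟩
  have g2 : ∃ X ∈ B, zdot u1 X = zdot u1 G + c ∧ zdot u2 X = zdot u2 G + c :=
    ⟨G', hG', by omega, dG⟩
  have e1 : ∃ X ∈ B, zdot u1 X = zdot u1 E ∧ zdot u2 X = zdot u2 E := ⟨E, hE, rfl, rfl⟩
  have e2 : ∃ X ∈ B, zdot u1 X = zdot u1 E + c ∧ zdot u2 X = zdot u2 E + c :=
    ⟨E', hE', by omega, dE⟩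
  have Bl1 := bd _ _ l1
  have Bl2 := bd _ _ l2
  have Br1 := bd _ _ r1
  have Br2 := bd _ _ r2
  have Bb1 := bd _ _ b1
  have Bb2 := bd _ _ b2
  have Bt1 := bd _ _ t1
  have Bt2 := bd _ _ t2
  have Bg1 := bd _ _ g1
  have Bg2 := bd _ _ g2
  have Be1 := bd _ _ e1
  have Be2 := bd _ _ e2
  have ca := defect_cases m u1 B h _ hw1
  have cb := defect_cases m u2 B h _ hw2
  have cc := defect_cases m (u1 - u2) B h _ hw3
  rw [hw3] at hqw
  rw [← har]
  refine ML hKi hKc (m : ℝ) (a : ℝ) (b : ℝ) (c : ℝ) x0 x1 y0 y1 yl yr xb xt (zdot u1 G : ℤ)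
    (zdot u2 G : ℤ) (zdot u1 E : ℤ) (zdot u2 E : ℤ) (by positivity) (by exact_mod_cast ha0)
    (by exact_mod_cast hb0) (by exact_mod_cast hc0) (by exact_mod_cast hp)
    (by push_cast at ca; exact ca) (by push_cast at cb; exact cb) (by push_cast at cc; exact cc)
    (by exact_mod_cast hpq) (by exact_mod_cast hqw)
    (mem _ _ l1) (by have := mem _ _ l2; push_cast at this; exact this)
    (mem _ _ r1) (by have := mem _ _ r2; push_cast at this; exact this)
    (mem _ _ b1) (by have := mem _ _ b2; push_cast at this; exact this)
    (mem _ _ t1) (by have := mem _ _ t2; push_cast at this; exact this)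
    (mem _ _ g1) (by have := mem _ _ g2; push_cast at this; exact this)
    (mem _ _ e1) (by have := mem _ _ e2; push_cast at this; exact this)
    ?_ ?_ ?_ ?_ ?_ ?_ ?_ ?_ ?_ ?_ ?_ ?_ ?_ ?_ ?_ ?_ ?_
  all_goals norm_cast
  all_goals omega

lemma prim_sum (m : ℕ) (B : Finset (ℤ × ℤ)) (h : B.Nonempty)
    (h2dim : ¬ Collinear ℝ (toR '' (B : Set (ℤ × ℤ))))
    (u1 u2 : ℤ × ℤ) (hdet : (u1.1 * u2.2 - u1.2 * u2.1) ^ 2 = 1) :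
    (defect m u1 B h : ℝ) ^ 2 + (defect m u2 B h : ℝ) ^ 2 + (defect m (u1 - u2) B h : ℝ) ^ 2 ≤
      ∑' u : {u : ℤ × ℤ // IsPrimDir u}, ((defect m u.1 B h : ℤ) : ℝ) ^ 2 := by
  classical
  have rep : ∀ u v : ℤ × ℤ, (u.1 * v.2 - u.2 * v.1) ^ 2 = 1 →
      ∃ r : {u : ℤ × ℤ // IsPrimDir u}, r.1 = u ∨ r.1 = -u := by
    intro u v hd
    have hcop : IsCoprime u.1 u.2 :=
      ⟨(u.1 * v.2 - u.2 * v.1) * v.2, -(u.1 * v.2 - u.2 * v.1) * v.1, by linear_combination hd⟩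
    by_cases hpos : 0 < u.2 ∨ (u.2 = 0 ∧ 0 < u.1)
    · exact ⟨⟨u, hcop, hpos⟩, Or.inl rfl⟩
    · refine ⟨⟨-u, ?_, ?_⟩, Or.inr rfl⟩
      · exact hcop.neg_neg
      · have h0 : ¬ (u.1 = 0 ∧ u.2 = 0) := by
          rintro ⟨h1, h2⟩; rw [h1, h2] at hd; simp at hd
        simp only [Prod.fst_neg, Prod.snd_neg]
        omega
  have hdet2 : (u2.1 * u1.2 - u2.2 * u1.1) ^ 2 = 1 := by rw [← hdet]; ring
  have hdet3 : ((u1 - u2).1 * u2.2 - (u1 - u2).2 * u2.1) ^ 2 = 1 := by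
    rw [← hdet]; simp only [Prod.fst_sub, Prod.snd_sub]; ring
  have hdet4 : ((u1 - u2).1 * u1.2 - (u1 - u2).2 * u1.1) ^ 2 = 1 := by
    rw [← hdet]; simp only [Prod.fst_sub, Prod.snd_sub]; ring
  have dne : ∀ u v : ℤ × ℤ, (u.1 * v.2 - u.2 * v.1) ^ 2 = 1 →
    ∀ r s : {u : ℤ × ℤ // IsPrimDir u}, (r.1 = u ∨ r.1 = -u) → (s.1 = v ∨ s.1 = -v) → r ≠ s := by
    rintro u v hd r _ hr hs rfl
    have : u = v ∨ u = -v := by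
      rcases hr with h1 | h1 <;> rcases hs with h2 | h2 <;> rw [h1] at h2
      · left; exact h2
      · right; exact h2
      · right; rw [← h2]; simp
      · left; exact neg_injective h2
    rcases this with rfl | rfl
    · ring_nf at hd; simp at hd
    · simp only [Prod.fst_neg, Prod.snd_neg] at hd; ring_nf at hd; simp at hd
  obtain ⟨r1, h1⟩ := rep u1 u2 hdet
  obtain ⟨r2, h2⟩ := rep u2 u1 hdet2
  obtain ⟨r3, h3⟩ := rep (u1 - u2) u2 hdet3
  have dr : ∀ (u : ℤ × ℤ) (r : {u : ℤ × ℤ // IsPrimDir u}), (r.1 = u ∨ r.1 = -u) →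
      defect m u B h = defect m r.1 B h := by
    intro u r hr
    rcases hr with e | e <;> rw [e]
    rw [defect_neg]
  rw [dr u1 r1 h1, dr u2 r2 h2, dr _ r3 h3]
  have n12 := dne u1 u2 hdet r1 r2 h1 h2
  have n31 := dne _ u1 hdet4 r3 r1 h3 h1
  have n32 := dne _ u2 hdet3 r3 r2 h3 h2
  have hsum : Summable fun u : {u : ℤ × ℤ // IsPrimDir u} => ((defect m u.1 B h : ℤ) : ℝ) ^ 2 := by
    apply summable_of_hasFiniteSupport
    have hf := finite_defect m B h h2dim
    refine (Set.Finite.preimage (Subtype.val_injective.injOn) hf).subset ?_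
    intro u hu
    simp only [Function.mem_support] at hu
    simp only [Set.mem_preimage, Set.mem_ofPred_eq]
    intro h0; apply hu; rw [h0]; simp
  have := hsum.sum_le_tsum {r1, r2, r3} (fun _ _ => sq_nonneg _)
  rw [Finset.sum_insert (by simp [n12, n31.symm]), Finset.sum_insert (by simp [n32.symm]),
    Finset.sum_singleton] at this
  linarith

/-- a minimiser of an integer-valued function bounded below by zero -/
lemma exists_min_on (S : Set (ℤ × ℤ)) (hS : S.Nonempty) (f : ℤ × ℤ → ℤ) (hf : ∀ x ∈ S, 0 ≤ f x) :
    ∃ x ∈ S, ∀ y ∈ S, f x ≤ f y := by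
  have hwf := (measure fun x => (f x).toNat).wf
  refine ⟨hwf.min S hS, hwf.min_mem S hS, fun y hy => ?_⟩
  have h1 := hwf.not_lt_min S hy
  have h2 := hf _ (hwf.min_mem S hS)
  have h3 := hf y hy
  have h4 : ¬ (f y).toNat < (f (hwf.min S hS)).toNat := h1
  omega

theorem area_plus_defects_ge_three_eighths (m : ℕ) (B : Finset (ℤ × ℤ)) (h : B.Nonempty)
    (hconv : latticeHull B = (B : Set (ℤ × ℤ)))
    (h2dim : ¬ Collinear ℝ (toR '' (B : Set (ℤ × ℤ))))
    (hthick : MThick m B) :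
    (3 / 8 : ℝ) * (m : ℝ) ^ 2 ≤
      areaOf B + (1 / 2 : ℝ) *
        ∑' u : {u : ℤ × ℤ // IsPrimDir u}, ((defect m u.1 B h : ℤ) : ℝ) ^ 2 := by
  have hth : ThickCond m B h := by
    rcases hthick with h0 | ⟨h', hcol, -⟩ | ⟨h', -, hth⟩
    · exact absurd h0 h.ne_empty
    · exact absurd hcol h2dim
    · exact hth
  have wnn : ∀ u, 0 ≤ widthZ u B h := by
    intro u
    obtain ⟨X, hX⟩ := h
    exact (abs_nonneg _).trans (width_ge u B ⟨X, hX⟩ hX hX)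
  obtain ⟨u1, hu1, min1⟩ := exists_min_on {u | IsCoprime u.1 u.2} ⟨(1, 0), isCoprime_one_left⟩
    (fun u => widthZ u B h) (fun u _ => wnn u)
  simp only [Set.mem_ofPred_eq] at hu1 min1
  obtain ⟨s, t, hst⟩ := hu1
  obtain ⟨u2, hu2, min2⟩ := exists_min_on {v | u1.1 * v.2 - u1.2 * v.1 = 1}
    ⟨(-t, s), by simp only [Set.mem_ofPred_eq]; linarith⟩ (fun u => widthZ u B h) (fun u _ => wnn u)
  simp only [Set.mem_ofPred_eq] at hu2 min2
  have hdet : (u1.1 * u2.2 - u1.2 * u2.1) ^ 2 = 1 := by rw [hu2]; norm_num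
  have hdet' : (u2.1 * u1.2 - u2.2 * u1.1) ^ 2 = 1 := by rw [← hdet]; ring
  have hdetn : ((-u1).1 * u2.2 - (-u1).2 * u2.1) ^ 2 = 1 := by
    rw [← hdet]; simp only [Prod.fst_neg, Prod.snd_neg]; ring
  have hpq : widthZ u1 B h ≤ widthZ u2 B h :=
    min1 u2 ⟨-u1.2, u1.1, by linarith⟩
  have hqm : widthZ u2 B h ≤ widthZ (u1 - u2) B h := by
    have := min2 (u2 - u1) (by simp only [Prod.fst_sub, Prod.snd_sub]; linarith)
    rw [← width_neg (u2 - u1), neg_sub] at this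
    exact this
  have hqp : widthZ u2 B h ≤ widthZ (-u1 - u2) B h := by
    have := min2 (u2 + u1) (by simp only [Prod.fst_add, Prod.snd_add]; linarith)
    rw [← width_neg (u2 + u1), neg_add_rev] at this
    rwa [sub_eq_add_neg]
  have hu10 : u1 ≠ 0 := by rintro rfl; simp at hu2
  have hpos := width_pos B h h2dim u1 hu10
  obtain ⟨⟨R, hR, R', hR', eR, eR', dR⟩, ⟨L, hL, L', hL', eL, eL', dL⟩⟩ :=
    face_points m B h hconv hth u1 u2 hdet
  obtain ⟨⟨T, hT, T', hT', eT, eT', dT⟩, ⟨O, hO, O', hO', eO, eO', dO⟩⟩ :=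
    face_points m B h hconv hth u2 u1 hdet'
  have bx := (width_bounds u1 B h).1
  have byy := (width_bounds u2 B h).1
  by_cases hs : zdot u2 L ≤ zdot u2 R ∨ zdot u1 O ≤ zdot u1 T
  · have st := step_lemma m B h hconv hth u1 u2 hdet _ _ _ _ (zdot u2 L) (zdot u2 R) (zdot u1 O)
      (zdot u1 T) bx byy ⟨L, hL, eL, rfl⟩ ⟨L', hL', eL', dL⟩ ⟨R, hR, eR, rfl⟩ ⟨R', hR', eR', dR⟩
      ⟨O, hO, rfl, eO⟩ ⟨O', hO', dO, eO'⟩ ⟨T, hT, rfl, eT⟩ ⟨T', hT', dT, eT'⟩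
      (by unfold widthZ at hpos; linarith) hpq hqm hs
    have ps := prim_sum m B h h2dim u1 u2 hdet
    linarith
  · push Not at hs
    have st := step_lemma m B h hconv hth (-u1) u2 hdetn (-B.sup' h (zdot u1)) (-B.inf' h (zdot u1))
      _ _ (zdot u2 R) (zdot u2 L) (-zdot u1 O') (-zdot u1 T')
      (fun X hX => by rw [zdot_neg_left]; have := bx X hX; omega) byy
      ⟨R, hR, by rw [zdot_neg_left, eR], rfl⟩ ⟨R', hR', by rw [zdot_neg_left, eR'], by rw [defect_neg, dR]⟩
      ⟨L, hL, by rw [zdot_neg_left, eL], rfl⟩ ⟨L', hL', by rw [zdot_neg_left, eL'], by rw [defect_neg, dL]⟩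
      ⟨O', hO', by rw [zdot_neg_left], eO'⟩ ⟨O, hO, by rw [zdot_neg_left, dO]; ring, eO⟩
      ⟨T', hT', by rw [zdot_neg_left], eT'⟩ ⟨T, hT, by rw [zdot_neg_left, dT]; ring, eT⟩
      (by unfold widthZ at hpos; linarith) (by unfold widthZ at hpq; linarith)
      (by unfold widthZ at hqp ⊢; linarith) (Or.inl hs.1.le)
    have ps := prim_sum m B h h2dim (-u1) u2 hdetn
    linarith
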